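/- arXiv:1812.11124 — 2 statements merged into one kernel-verified Lean document; each statement's English description precedes it below -/
import Mathlib

section
/- Let C be a Cayley algebra and K a 2-dimensional Hurwitz algebra over F. Consider the subspace S := C₀⊗1 ⊕ 1⊗K₀ of the tensor product algebra C⊗K, with bracket [a,b] := ab − ba computed in C⊗K. Then [S,S] = C₀⊗1, and the centralizer {a ∈ S : [a,s] = 0 for all s ∈ S} equals 1⊗K₀. -/
open scoped TensorProduct

noncomputable section

/-- A Hurwitz algebra structure: `n` is a multiplicative quadratic form whose polar
form is nondegenerate, on a finite-dimensional unital (not necessarily associative)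
`F`-algebra `B`. -/
def IsHurwitz (F : Type*) [Field F] {B : Type*} [NonAssocRing B] [Module F B]
    (n : QuadraticForm F B) : Prop :=
  FiniteDimensional F B ∧
    (∀ x : B, (∀ y : B, QuadraticMap.polar n x y = 0) → x = 0) ∧
    (∀ x y : B, n (x * y) = n x * n y)

/-- The standard conjugation `x ↦ n(x,1)·1 - x` of a Hurwitz algebra, as a linear map. -/
def hconj (F : Type*) [Field F] {B : Type*} [NonAssocRing B] [Module F B]
    (n : QuadraticForm F B) : B →ₗ[F] B where
  toFun x := QuadraticMap.polar n x 1 • (1 : B) - x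
  map_add' x y := by
    simp only [QuadraticMap.polar_add_left, add_smul]
    abel
  map_smul' c x := by
    simp [QuadraticMap.polar_smul_left, smul_sub, mul_smul]

/-- The subspace `B₀ = {x ∈ B : x̄ = -x}` of skew elements of a Hurwitz algebra. -/
def skewPart (F : Type*) [Field F] {B : Type*} [NonAssocRing B] [Module F B]
    (n : QuadraticForm F B) : Submodule F B where
  carrier := {x | hconj F n x = -x}
  add_mem' := by
    intro a b ha hb
    simp only [Set.mem_setOf_eq, map_add] at *
    rw [ha, hb]; abel
  zero_mem' := by simp
  smul_mem' := by
    intro c x hx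
    simp only [Set.mem_setOf_eq, map_smul] at *
    rw [hx, smul_neg]

/-- The subspace `C₀ ⊗ 1` of `C ⊗ K`. -/
def skewLeft (F : Type*) [Field F] {C K : Type*} [NonAssocRing C] [Module F C]
    [NonAssocRing K] [Module F K] (nC : QuadraticForm F C) : Submodule F (C ⊗[F] K) :=
  (skewPart F nC).map ((TensorProduct.mk F C K).flip (1 : K))

/-- The subspace `1 ⊗ K₀` of `C ⊗ K`. -/
def skewRight (F : Type*) [Field F] {C K : Type*} [NonAssocRing C] [Module F C]
    [NonAssocRing K] [Module F K] (nK : QuadraticForm F K) : Submodule F (C ⊗[F] K) :=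
  (skewPart F nK).map (TensorProduct.mk F C K (1 : C))

namespace IsHurwitz

open QuadraticMap

variable {F : Type*} [Field F] {B : Type*} [NonAssocRing B] [Module F B]
  {n : QuadraticForm F B}

theorem ext_polar (h : IsHurwitz F n) {x y : B} (hxy : ∀ z, polar n x z = polar n y z) :
    x = y := by
  rw [← sub_eq_zero]
  refine h.2.1 _ fun z => ?_
  rw [polar_sub_left, hxy, sub_self]

theorem polar_self' (n : QuadraticForm F B) (x : B) : polar n x x = 2 * n x := by
  rw [QuadraticMap.polar_self, two_smul, two_mul]

theorem norm_one (h : IsHurwitz F n) (hdim : 0 < Module.finrank F B) : n 1 = 1 := by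
  have hne : ∃ x, n x ≠ 0 := by
    by_contra! h0
    have := h.1
    obtain ⟨x, hx⟩ := (Module.finrank_pos_iff_exists_ne_zero (R := F) (M := B)).mp hdim
    exact hx (h.2.1 x fun y => by simp [polar, h0])
  obtain ⟨x, hx⟩ := hne
  have h1 := h.2.2 1 x
  rw [one_mul] at h1
  exact (mul_right_cancel₀ hx (by rw [one_mul, ← h1])).symm

theorem polar_mul_mul_left (h : IsHurwitz F n) (x y z : B) :
    polar n (x * y) (x * z) = n x * polar n y z := by
  simp only [polar, ← mul_add, h.2.2]
  ring

theorem polar_mul_add_polar_mul (h : IsHurwitz F n) (x y z w : B) :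
    polar n (x * y) (w * z) + polar n (w * y) (x * z) = polar n x w * polar n y z := by
  have h1 := h.polar_mul_mul_left (x + w) y z
  have h2 : n (x + w) = polar n x w + n x + n w := by simp only [polar]; ring
  simp only [add_mul, polar_add_left, polar_add_right, h.polar_mul_mul_left, h2] at h1
  linear_combination h1

theorem mem_skewPart (h1 : n 1 = 1) {x : B} :
    x ∈ skewPart F n ↔ polar n x 1 = 0 := by
  have hone : (1 : B) ≠ 0 := fun h0 => by simp [h0] at h1
  change polar n x 1 • (1 : B) - x = -x ↔ _
  rw [sub_eq_neg_self, smul_eq_zero, or_iff_left hone]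

/-- Left multiplication by a skew element is skew-adjoint for the norm. -/
theorem polar_mul_left_of_skew (h : IsHurwitz F n) {x : B} (hx : polar n x 1 = 0) (y z : B) :
    polar n (x * y) z = -polar n y (x * z) := by
  have := h.polar_mul_add_polar_mul x y z 1
  rw [one_mul, one_mul, hx, zero_mul] at this
  linear_combination this

theorem mul_mul_self_of_skew (h : IsHurwitz F n) {x : B} (hx : polar n x 1 = 0) (y : B) :
    x * (x * y) = -(n x • y) := by
  refine h.ext_polar fun z => ?_
  rw [h.polar_mul_left_of_skew hx, h.polar_mul_mul_left, polar_neg_left, polar_smul_left,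
    smul_eq_mul]

theorem mul_add_mul_of_skew (h : IsHurwitz F n) {x y : B} (hx : polar n x 1 = 0)
    (hy : polar n y 1 = 0) : x * y + y * x = -(polar n x y • (1 : B)) := by
  have hxy : polar n (x + y) 1 = 0 := by rw [polar_add_left, hx, hy, add_zero]
  have e1 := h.mul_mul_self_of_skew hxy 1
  have e2 := h.mul_mul_self_of_skew hx 1
  have e3 := h.mul_mul_self_of_skew hy 1
  rw [mul_one] at e1 e2 e3
  rw [polar, sub_smul, sub_smul]
  have e4 : x * y + y * x = (x + y) * (x + y) - x * x - y * y := by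
    rw [add_mul, mul_add, mul_add]; abel
  rw [e4, e1, e2, e3]
  abel

theorem polar_mul_one_of_skew (h : IsHurwitz F n) {x : B} (hx : polar n x 1 = 0) (y : B) :
    polar n (x * y) 1 = -polar n x y := by
  rw [h.polar_mul_left_of_skew hx, mul_one, polar_comm]

theorem polar_commutator_one (h : IsHurwitz F n) {x y : B} (hx : polar n x 1 = 0)
    (hy : polar n y 1 = 0) : polar n (x * y - y * x) 1 = 0 := by
  rw [polar_sub_left, h.polar_mul_one_of_skew hx, h.polar_mul_one_of_skew hy, polar_comm n y x,
    sub_self]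

theorem commutator_of_skew (h : IsHurwitz F n) {x y : B} (hx : polar n x 1 = 0)
    (hy : polar n y 1 = 0) : x * y - y * x = (2 : F) • (x * y) + polar n x y • (1 : B) := by
  rw [eq_sub_of_add_eq' (h.mul_add_mul_of_skew hx hy), two_smul]
  abel

/-- A skew element orthogonal to an anisotropic skew element `a` is a multiple of a commutator
`[a, a * x]` of skew elements. -/
theorem eq_smul_commutator (h : IsHurwitz F n) (hF : (2 : F) ≠ 0) {a x : B}
    (ha : polar n a 1 = 0) (hna : n a ≠ 0) (hx : polar n x 1 = 0) (hax : polar n x a = 0) :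
    polar n (a * x) 1 = 0 ∧ x = (-(2 * n a)⁻¹) • (a * (a * x) - a * x * a) := by
  have h1 : polar n (a * x) 1 = 0 := by
    rw [h.polar_mul_one_of_skew ha, polar_comm, hax, neg_zero]
  have h2 : polar n a (a * x) = 0 := by
    have := h.polar_mul_mul_left a 1 x
    rwa [mul_one, polar_comm n 1 x, hx, mul_zero] at this
  refine ⟨h1, ?_⟩
  rw [h.commutator_of_skew ha h1, h2, h.mul_mul_self_of_skew ha, zero_smul, add_zero, smul_neg,
    smul_neg, neg_smul, neg_neg, smul_smul, smul_smul, mul_assoc,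
    inv_mul_cancel₀ (mul_ne_zero hF hna), one_smul]

/-- If `1` and `a` span a nondegenerate subspace, then some anisotropic vector is orthogonal
to both. -/
theorem exists_anisotropic_orthogonal (h : IsHurwitz F n)
    (hdim : 2 < Module.finrank F B) (a : B)
    (hdec : ∀ y, ∃ s t : F, polar n (y - s • (1 : B) - t • a) 1 = 0 ∧
      polar n (y - s • (1 : B) - t • a) a = 0) :
    ∃ b, polar n b 1 = 0 ∧ polar n b a = 0 ∧ n b ≠ 0 := by
  have := h.1
  by_contra! h0
  let f : B →ₗ[F] F × F := ((polarBilin n).flip 1).prod ((polarBilin n).flip a)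
  have hker : LinearMap.ker f ≠ ⊥ := LinearMap.ker_ne_bot_of_finrank_lt (by simpa using hdim)
  obtain ⟨w, hw, hw0⟩ := (Submodule.ne_bot_iff _).mp hker
  have hw' : polar n w 1 = 0 ∧ polar n w a = 0 := by
    simpa [f] using hw
  refine hw0 (h.2.1 w fun y => ?_)
  obtain ⟨s, t, h1, h2⟩ := hdec y
  set v := y - s • (1 : B) - t • a with hv
  have hy : y = v + t • a + s • (1 : B) := by rw [hv]; abel
  have hwv : polar n w v = 0 := by
    have := h0 (w + v) (by rw [polar_add_left, hw'.1, h1, add_zero])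
      (by rw [polar_add_left, hw'.2, h2, add_zero])
    rw [polar, this, h0 w hw'.1 hw'.2, h0 v h1 h2, sub_zero, sub_zero]
  rw [hy, polar_add_right, polar_add_right, polar_smul_right, polar_smul_right, hw'.1, hw'.2, hwv]
  simp

theorem exists_anisotropic_skew (h : IsHurwitz F n) (hF : (2 : F) ≠ 0)
    (hdim : 2 < Module.finrank F B) : ∃ a, polar n a 1 = 0 ∧ n a ≠ 0 := by
  have h1 := h.norm_one (by omega)
  obtain ⟨a, ha, -, hna⟩ := h.exists_anisotropic_orthogonal hdim 1 fun y => by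
    refine ⟨polar n y 1 / 2, 0, ?_⟩
    rw [and_self, zero_smul, sub_zero, polar_sub_left, polar_smul_left, polar_self', h1,
      smul_eq_mul]
    field_simp
    ring
  exact ⟨a, ha, hna⟩

theorem exists_anisotropic_skew_orthogonal (h : IsHurwitz F n) (hF : (2 : F) ≠ 0)
    (hdim : 2 < Module.finrank F B) {a : B} (ha : polar n a 1 = 0) (hna : n a ≠ 0) :
    ∃ b, polar n b 1 = 0 ∧ polar n b a = 0 ∧ n b ≠ 0 := by
  have h1 := h.norm_one (by omega)
  refine h.exists_anisotropic_orthogonal hdim a fun y => ?_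
  refine ⟨polar n y 1 / 2, polar n y a / (2 * n a), ?_, ?_⟩
  · rw [polar_sub_left, polar_sub_left, polar_smul_left, polar_smul_left, polar_self', h1, ha,
      smul_eq_mul, smul_eq_mul]
    field_simp
    ring
  · rw [polar_sub_left, polar_sub_left, polar_smul_left, polar_smul_left, polar_self',
      polar_comm n 1 a, ha, smul_eq_mul, smul_eq_mul]
    field_simp
    ring

/-- In dimension greater than two, every skew element is a linear combination of commutators of
skew elements. -/
theorem mem_of_commutator_mem (h : IsHurwitz F n) (hF : (2 : F) ≠ 0)
    (hdim : 2 < Module.finrank F B) (T : Submodule F B)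
    (hT : ∀ x y, polar n x 1 = 0 → polar n y 1 = 0 → x * y - y * x ∈ T) {x : B}
    (hx : polar n x 1 = 0) : x ∈ T := by
  have key : ∀ a y, polar n a 1 = 0 → n a ≠ 0 → polar n y 1 = 0 → polar n y a = 0 → y ∈ T := by
    intro a y ha hna hy hya
    obtain ⟨h1, h2⟩ := h.eq_smul_commutator hF ha hna hy hya
    rw [h2]
    exact T.smul_mem _ (hT _ _ ha h1)
  obtain ⟨a, ha, hna⟩ := h.exists_anisotropic_skew hF hdim
  obtain ⟨b, hb, hba, hnb⟩ := h.exists_anisotropic_skew_orthogonal hF hdim ha hna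
  have haT : a ∈ T := key b a hb hnb ha (by rw [polar_comm, hba])
  rw [← sub_add_cancel x ((polar n x a / (2 * n a)) • a)]
  refine T.add_mem (key a _ ha hna ?_ ?_) (T.smul_mem _ haT)
  · rw [polar_sub_left, polar_smul_left, hx, ha, smul_zero, sub_zero]
  · rw [polar_sub_left, polar_smul_left, polar_self', smul_eq_mul]
    field_simp
    ring

/-- In dimension greater than two, a skew element commuting with all skew elements vanishes. -/
theorem eq_zero_of_commute_skew [SMulCommClass F B B] (h : IsHurwitz F n) (hF : (2 : F) ≠ 0)
    (hdim : 2 < Module.finrank F B) {x : B} (hx : polar n x 1 = 0)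
    (hcomm : ∀ y, polar n y 1 = 0 → x * y - y * x = 0) : x = 0 := by
  have h1 := h.norm_one (by omega)
  have key : ∀ y, polar n y 1 = 0 → (2 * n x) • y = polar n x y • x := by
    intro y hy
    have e := hcomm y hy
    rw [h.commutator_of_skew hx hy] at e
    have e' := congrArg (x * ·) e
    simp only [mul_add, mul_smul_comm, mul_one, mul_zero, h.mul_mul_self_of_skew hx] at e'
    rw [smul_neg, smul_smul, neg_add_eq_zero] at e'
    exact e'
  by_cases hnx : n x = 0
  · by_contra hx0
    refine hx0 (h.2.1 x fun y => ?_)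
    have hs : polar n (y - (polar n y 1 / 2) • (1 : B)) 1 = 0 := by
      rw [polar_sub_left, polar_smul_left, polar_self', h1, smul_eq_mul]
      field_simp
      ring
    have e := key _ hs
    rw [hnx, mul_zero, zero_smul, eq_comm, smul_eq_zero, or_iff_left hx0, polar_sub_right,
      polar_smul_right, hx, smul_zero, sub_zero] at e
    exact e
  · obtain ⟨b, hb, hbx, hnb⟩ := h.exists_anisotropic_skew_orthogonal hF hdim hx hnx
    have e := key b hb
    rw [polar_comm, hbx, zero_smul, smul_eq_zero] at e
    rcases e with e | e
    · exact absurd e (mul_ne_zero hF hnx)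
    · exact absurd (by rw [e, map_zero]) hnb

/-- The skew part of a two-dimensional Hurwitz algebra is commutative. -/
theorem mul_comm_of_skew [SMulCommClass F B B] [IsScalarTower F B B] (h : IsHurwitz F n)
    (hF : (2 : F) ≠ 0) (hdim : Module.finrank F B = 2) {x y : B} (hx : polar n x 1 = 0)
    (hy : polar n y 1 = 0) : x * y = y * x := by
  have := h.1
  have h1 := h.norm_one (by omega)
  let f : B →ₗ[F] F := (polarBilin n).flip 1
  have hf1 : f 1 ≠ 0 := by simpa [f, polar_self', h1] using hF
  have hsurj : Function.Surjective f := LinearMap.surjective fun h0 => hf1 (by simp [h0])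
  have hfin := f.finrank_range_add_finrank_ker
  rw [LinearMap.range_eq_top.mpr hsurj, finrank_top, Module.finrank_self, hdim] at hfin
  obtain ⟨v, hv⟩ := finrank_le_one_iff.mp (show Module.finrank F (LinearMap.ker f) ≤ 1 by omega)
  obtain ⟨s, hs⟩ := hv ⟨x, hx⟩
  obtain ⟨t, ht⟩ := hv ⟨y, hy⟩
  have hs' : s • (v : B) = x := congrArg Subtype.val hs
  have ht' : t • (v : B) = y := congrArg Subtype.val ht
  rw [← hs', ← ht', smul_mul_smul_comm, smul_mul_smul_comm, mul_comm s t]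

end IsHurwitz

/-- Over a field, `x ↦ x ⊗ 1` is injective as soon as some linear functional does not vanish
at `1`. -/
theorem eq_zero_of_tmul_one_eq_zero {F C K : Type*} [Field F] [AddCommGroup C] [Module F C]
    [NonAssocRing K] [Module F K] (φ : K →ₗ[F] F) (hφ : φ 1 ≠ 0) {x : C}
    (hx : x ⊗ₜ[F] (1 : K) = 0) : x = 0 := by
  have h := congrArg (fun z => TensorProduct.rid F C (φ.lTensor C z)) hx
  simpa [hφ] using h

theorem mem_skewLeft_sup_skewRight {F C K : Type*} [Field F] [NonAssocRing C] [Module F C]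
    [NonAssocRing K] [Module F K] {nC : QuadraticForm F C} {nK : QuadraticForm F K}
    {z : C ⊗[F] K} : z ∈ skewLeft F nC ⊔ skewRight F nK ↔
      ∃ c ∈ skewPart F nC, ∃ k ∈ skewPart F nK, c ⊗ₜ[F] (1 : K) + (1 : C) ⊗ₜ[F] k = z := by
  simp [Submodule.mem_sup, skewLeft, skewRight]

theorem tmul_one_add_one_tmul_commutator {F C K : Type*} [Field F] [NonAssocRing C] [Module F C]
    [SMulCommClass F C C] [IsScalarTower F C C] [NonAssocRing K] [Module F K]
    [SMulCommClass F K K] [IsScalarTower F K K] (c d : C) {k l : K} (hkl : k * l = l * k) :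
    (c ⊗ₜ[F] (1 : K) + (1 : C) ⊗ₜ[F] k) * (d ⊗ₜ[F] (1 : K) + (1 : C) ⊗ₜ[F] l) -
      (d ⊗ₜ[F] (1 : K) + (1 : C) ⊗ₜ[F] l) * (c ⊗ₜ[F] (1 : K) + (1 : C) ⊗ₜ[F] k) =
      (c * d - d * c) ⊗ₜ[F] (1 : K) := by
  simp only [mul_add, add_mul, Algebra.TensorProduct.tmul_mul_tmul, mul_one, one_mul, hkl,
    TensorProduct.sub_tmul]
  abel

/-- Let `C` be a Cayley algebra and `K` a 2-dimensional Hurwitz algebra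
over a field `F` of characteristic `≠ 2`, and let `S = C₀ ⊗ 1 ⊕ 1 ⊗ K₀ ⊆ C ⊗ K` with the
bracket `[a,b] = ab - ba` computed in `C ⊗ K`.  Then `[S,S] = C₀ ⊗ 1`, and the centralizer
`{a ∈ S : [a,s] = 0 for all s ∈ S}` equals `1 ⊗ K₀`. -/
theorem bracket_and_centralizer_in_cayley_tensor_quadratic (F : Type*) [Field F]
    (hF : (2 : F) ≠ 0)
    (C K : Type*) [NonAssocRing C] [Module F C] [SMulCommClass F C C] [IsScalarTower F C C]
    [NonAssocRing K] [Module F K] [SMulCommClass F K K] [IsScalarTower F K K]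
    (nC : QuadraticForm F C) (nK : QuadraticForm F K)
    (hC : IsHurwitz F nC) (hdimC : Module.finrank F C = 8)
    (hK : IsHurwitz F nK) (hdimK : Module.finrank F K = 2) :
    Submodule.span F {z : C ⊗[F] K |
        ∃ x ∈ skewLeft F nC ⊔ skewRight F nK, ∃ y ∈ skewLeft F nC ⊔ skewRight F nK,
          z = x * y - y * x} = skewLeft F nC ∧
      {a : C ⊗[F] K | a ∈ skewLeft F nC ⊔ skewRight F nK ∧
          ∀ s ∈ skewLeft F nC ⊔ skewRight F nK, a * s - s * a = 0} =
        ↑(skewRight F nK (C := C)) := by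
  have hC1 := hC.norm_one (by omega)
  have hK1 := hK.norm_one (by omega)
  have hbr : ∀ (c d : C), ∀ k ∈ skewPart F nK, ∀ l ∈ skewPart F nK, _ :=
    fun c d k hk l hl => tmul_one_add_one_tmul_commutator (F := F) c d
      (hK.mul_comm_of_skew hF hdimK ((IsHurwitz.mem_skewPart hK1).mp hk)
        ((IsHurwitz.mem_skewPart hK1).mp hl))
  refine ⟨le_antisymm ?_ ?_, Set.Subset.antisymm ?_ ?_⟩
  · rw [Submodule.span_le]
    rintro z ⟨x, hx, y, hy, rfl⟩
    obtain ⟨c, hc, k, hk, rfl⟩ := mem_skewLeft_sup_skewRight.mp hx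
    obtain ⟨d, hd, l, hl, rfl⟩ := mem_skewLeft_sup_skewRight.mp hy
    rw [hbr c d k hk l hl]
    refine ⟨c * d - d * c, (IsHurwitz.mem_skewPart hC1).mpr ?_, rfl⟩
    exact hC.polar_commutator_one ((IsHurwitz.mem_skewPart hC1).mp hc)
      ((IsHurwitz.mem_skewPart hC1).mp hd)
  · refine Submodule.map_le_iff_le_comap.mpr fun c hc => ?_
    refine hC.mem_of_commutator_mem hF (by omega) _ (fun x y hx hy => ?_)
      ((IsHurwitz.mem_skewPart hC1).mp hc)
    refine Submodule.subset_span ⟨x ⊗ₜ 1 + 1 ⊗ₜ 0, mem_skewLeft_sup_skewRight.mpr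
      ⟨x, (IsHurwitz.mem_skewPart hC1).mpr hx, 0, zero_mem _, rfl⟩, y ⊗ₜ 1 + 1 ⊗ₜ 0,
      mem_skewLeft_sup_skewRight.mpr
      ⟨y, (IsHurwitz.mem_skewPart hC1).mpr hy, 0, zero_mem _, rfl⟩, ?_⟩
    exact (hbr x y 0 (zero_mem _) 0 (zero_mem _)).symm
  · rintro a ⟨ha, hcomm⟩
    obtain ⟨c, hc, k, hk, rfl⟩ := mem_skewLeft_sup_skewRight.mp ha
    have hc0 : c = 0 := by
      refine hC.eq_zero_of_commute_skew hF (by omega) ((IsHurwitz.mem_skewPart hC1).mp hc)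
        fun d hd => ?_
      have e := hcomm _ (mem_skewLeft_sup_skewRight.mpr
        ⟨d, (IsHurwitz.mem_skewPart hC1).mpr hd, 0, zero_mem _, rfl⟩)
      rw [hbr c d k hk 0 (zero_mem _)] at e
      refine eq_zero_of_tmul_one_eq_zero ((QuadraticMap.polarBilin nK).flip 1) ?_ e
      simpa [IsHurwitz.polar_self', hK1] using hF
    rw [hc0, TensorProduct.zero_tmul, zero_add]
    exact ⟨k, hk, rfl⟩
  · rintro _ ⟨k, hk, rfl⟩
    refine ⟨Submodule.mem_sup_right ⟨k, hk, rfl⟩, fun s hs => ?_⟩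
    obtain ⟨d, hd, l, hl, rfl⟩ := mem_skewLeft_sup_skewRight.mp hs
    have e := hbr 0 d k hk l hl
    rwa [TensorProduct.zero_tmul, zero_add, zero_mul, mul_zero, sub_zero,
      TensorProduct.zero_tmul] at e
end
end

section
/- Let C be a Cayley algebra over F and T := T(C⊗C) the Smirnov algebra. Then the smallest F-subspace of C⊗C containing the set {s⊗1 + 1⊗s : s ∈ C₀} and closed under the multiplication of C⊗C is exactly T(C⊗C); that is, the subalgebra of T(C⊗C) generated by its subspace of skew elements S = {s⊗1 + 1⊗s : s ∈ C₀} is all of T(C⊗C). -/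
open scoped TensorProduct

noncomputable section

/-- The Smirnov algebra `T(C⊗C) = span{ a⊗a - n(a)·1⊗1 : a ∈ C } ⊆ C ⊗ C`. -/
def smirnovT (F : Type*) [Field F] {C : Type*} [NonAssocRing C] [Module F C]
    (n : QuadraticForm F C) : Submodule F (C ⊗[F] C) :=
  Submodule.span F {x : C ⊗[F] C | ∃ a : C, x = a ⊗ₜ[F] a - n a • ((1 : C) ⊗ₜ[F] (1 : C))}

/-- The involution `σ` of `C ⊗ C`: the tensor product of the standard involutions. -/
def sigmaT (F : Type*) [Field F] {C : Type*} [NonAssocRing C] [Module F C]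
    (n : QuadraticForm F C) : C ⊗[F] C →ₗ[F] C ⊗[F] C :=
  TensorProduct.map (hconj F n) (hconj F n)

section Hurwitz

variable {F : Type*} [Field F] {B : Type*} [NonAssocRing B] [Module F B]
  {n : QuadraticForm F B}

lemma IsHurwitz.map_one [Nontrivial B] (hB : IsHurwitz F n) : n 1 = 1 := by
  obtain ⟨-, hnd, hmul⟩ := hB
  by_contra h
  have hzero : ∀ x, n x = 0 := fun x => by
    have hx : n x * (n 1 - 1) = 0 := by
      have := hmul x 1
      rw [mul_one] at this
      linear_combination -this
    exact (mul_eq_zero.mp hx).resolve_right (sub_ne_zero.mpr h)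
  exact one_ne_zero (hnd (1 : B) fun y => by simp [QuadraticMap.polar, hzero])

lemma IsHurwitz.polar_one_one [Nontrivial B] (hB : IsHurwitz F n) :
    QuadraticMap.polar n 1 1 = 2 := by
  rw [QuadraticMap.polar_self, hB.map_one, nsmul_eq_mul, mul_one, Nat.cast_ofNat]

lemma IsHurwitz.polar_mul_left (hB : IsHurwitz F n) (x y z : B) :
    QuadraticMap.polar n (x * y) (x * z) = n x * QuadraticMap.polar n y z := by
  simp only [QuadraticMap.polar, ← mul_add, hB.2.2]
  ring

lemma IsHurwitz.polar_mul_add_polar_mul_s16 (hB : IsHurwitz F n) (x y z : B) :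
    QuadraticMap.polar n (x * y) z + QuadraticMap.polar n y (x * z) =
      QuadraticMap.polar n x 1 * QuadraticMap.polar n y z := by
  have h := hB.polar_mul_left (x + 1) y z
  have h1 := hB.polar_mul_left 1 y z
  have hx := hB.polar_mul_left x y z
  simp only [add_mul, one_mul, QuadraticMap.polar_add_left, QuadraticMap.polar_add_right] at h h1
  have hp : QuadraticMap.polar n x 1 = n (x + 1) - n x - n 1 := rfl
  rw [hp]
  linear_combination h - hx - h1

lemma IsHurwitz.mul_self_of_polar_one_eq_zero (hB : IsHurwitz F n) {s : B}
    (hs : QuadraticMap.polar n s 1 = 0) : s * s = -(n s • (1 : B)) := by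
  refine eq_neg_of_add_eq_zero_left (hB.2.1 _ fun z => ?_)
  have h := hB.polar_mul_add_polar_mul_s16 s s z
  have h1 := hB.polar_mul_left s 1 z
  rw [mul_one] at h1
  rw [hs] at h
  rw [QuadraticMap.polar_add_left, QuadraticMap.polar_smul_left, smul_eq_mul]
  linear_combination h - h1

lemma hconj_eq_neg_iff [Nontrivial B] {s : B} :
    hconj F n s = -s ↔ QuadraticMap.polar n s 1 = 0 := by
  change QuadraticMap.polar n s 1 • (1 : B) - s = -s ↔ _
  rw [sub_eq_neg_self, smul_eq_zero_iff_left one_ne_zero]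

lemma map_smul_one_add [Nontrivial B] (hB : IsHurwitz F n) (c : F) {s : B}
    (hs : QuadraticMap.polar n s 1 = 0) : n (c • 1 + s) = c * c + n s := by
  have h : QuadraticMap.polar n (c • 1) s = 0 := by
    rw [QuadraticMap.polar_smul_left, QuadraticMap.polar_comm, hs, smul_zero]
  have h' : n (c • 1 + s) - n (c • 1) - n s = 0 := h
  rw [QuadraticMap.map_smul, hB.map_one, smul_eq_mul, mul_one] at h'
  linear_combination h'

lemma tmul_self_sub_smul_one_add [Nontrivial B] (hB : IsHurwitz F n) (c : F) {s : B}
    (hs : QuadraticMap.polar n s 1 = 0) :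
    (c • 1 + s) ⊗ₜ[F] (c • 1 + s) - n (c • 1 + s) • ((1 : B) ⊗ₜ[F] (1 : B)) =
      c • (s ⊗ₜ[F] (1 : B) + (1 : B) ⊗ₜ[F] s) +
        (s ⊗ₜ[F] s - n s • ((1 : B) ⊗ₜ[F] (1 : B))) := by
  rw [map_smul_one_add hB c hs]
  simp only [TensorProduct.add_tmul, TensorProduct.tmul_add, ← TensorProduct.smul_tmul',
    TensorProduct.tmul_smul]
  module

variable [SMulCommClass F B B] [IsScalarTower F B B]

lemma IsHurwitz.skew_mul_self (hB : IsHurwitz F n) {s : B}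
    (hs : QuadraticMap.polar n s 1 = 0) :
    (s ⊗ₜ[F] (1 : B) + (1 : B) ⊗ₜ[F] s) * (s ⊗ₜ[F] (1 : B) + (1 : B) ⊗ₜ[F] s) =
      (2 : F) • (s ⊗ₜ[F] s - n s • ((1 : B) ⊗ₜ[F] (1 : B))) := by
  simp only [mul_add, add_mul, Algebra.TensorProduct.tmul_mul_tmul, mul_one, one_mul,
    hB.mul_self_of_polar_one_eq_zero hs, TensorProduct.neg_tmul, TensorProduct.tmul_neg,
    ← TensorProduct.smul_tmul', TensorProduct.tmul_smul]
  module

lemma mul_mem_smirnovT (hB : IsHurwitz F n) {x y : B ⊗[F] B}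
    (hx : x ∈ smirnovT F n) (hy : y ∈ smirnovT F n) : x * y ∈ smirnovT F n := by
  have hgen (a : B) : a ⊗ₜ[F] a - n a • ((1 : B) ⊗ₜ[F] (1 : B)) ∈ smirnovT F n :=
    Submodule.subset_span ⟨a, rfl⟩
  induction hx, hy using Submodule.span_induction₂ with
  | mem_mem x y hx hy =>
    obtain ⟨a, rfl⟩ := hx
    obtain ⟨b, rfl⟩ := hy
    have h : (a ⊗ₜ[F] a - n a • ((1 : B) ⊗ₜ[F] (1 : B))) *
        (b ⊗ₜ[F] b - n b • ((1 : B) ⊗ₜ[F] (1 : B))) =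
        ((a * b) ⊗ₜ[F] (a * b) - n (a * b) • ((1 : B) ⊗ₜ[F] (1 : B))) -
          n b • (a ⊗ₜ[F] a - n a • ((1 : B) ⊗ₜ[F] (1 : B))) -
          n a • (b ⊗ₜ[F] b - n b • ((1 : B) ⊗ₜ[F] (1 : B))) := by
      simp only [sub_mul, mul_sub, smul_mul_assoc, mul_smul_comm,
        Algebra.TensorProduct.tmul_mul_tmul, mul_one, one_mul, hB.2.2]
      module
    rw [h]
    exact sub_mem (sub_mem (hgen _) (Submodule.smul_mem _ _ (hgen _)))
      (Submodule.smul_mem _ _ (hgen _))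
  | zero_left y _ => simp
  | zero_right x _ => simp
  | add_left x y z _ _ _ h₁ h₂ => rw [add_mul]; exact add_mem h₁ h₂
  | add_right x y z _ _ _ h₁ h₂ => rw [mul_add]; exact add_mem h₁ h₂
  | smul_left r x y _ _ h => rw [smul_mul_assoc]; exact Submodule.smul_mem _ _ h
  | smul_right r x y _ _ h => rw [mul_smul_comm]; exact Submodule.smul_mem _ _ h

end Hurwitz

/-- Let `C` be a Cayley algebra over a field `F` of characteristic `≠ 2`.
The smallest `F`-subspace of `C ⊗ C` containing the set `S = {s⊗1 + 1⊗s : s ∈ C₀}` of skew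
elements of the Smirnov algebra and closed under the multiplication of `C ⊗ C` is exactly
the Smirnov algebra `T(C⊗C)`. -/
theorem smirnov_generated_by_skew (F : Type*) [Field F] (hF : (2 : F) ≠ 0)
    (C : Type*) [NonAssocRing C] [Module F C] [SMulCommClass F C C] [IsScalarTower F C C]
    (n : QuadraticForm F C) (hC : IsHurwitz F n) (hdim : Module.finrank F C = 8) :
    smirnovT F n = sInf {W : Submodule F (C ⊗[F] C) |
      {x : C ⊗[F] C | ∃ s : C, hconj F n s = -s ∧ x = s ⊗ₜ[F] (1 : C) + (1 : C) ⊗ₜ[F] s} ⊆ ↑W ∧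
        ∀ x ∈ W, ∀ y ∈ W, x * y ∈ W} := by
  have : Nontrivial C := Module.nontrivial_of_finrank_pos (R := F) (by omega)
  apply le_antisymm
  · refine le_sInf fun W ⟨hS, hmul⟩ => Submodule.span_le.mpr ?_
    rintro _ ⟨a, rfl⟩
    obtain ⟨c, s, hs, rfl⟩ :
        ∃ (c : F) (s : C), QuadraticMap.polar n s 1 = 0 ∧ a = c • 1 + s := by
      refine ⟨QuadraticMap.polar n a 1 / 2, a - (QuadraticMap.polar n a 1 / 2) • 1, ?_, by abel⟩
      rw [QuadraticMap.polar_sub_left, QuadraticMap.polar_smul_left, hC.polar_one_one,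
        smul_eq_mul, div_mul_cancel₀ _ hF, sub_self]
    have hD : s ⊗ₜ[F] (1 : C) + (1 : C) ⊗ₜ[F] s ∈ W := hS ⟨s, hconj_eq_neg_iff.mpr hs, rfl⟩
    have hsq := hmul _ hD _ hD
    rw [hC.skew_mul_self hs, Submodule.smul_mem_iff _ hF] at hsq
    rw [SetLike.mem_coe, tmul_self_sub_smul_one_add hC _ hs]
    exact add_mem (Submodule.smul_mem _ _ hD) hsq
  · refine sInf_le ⟨?_, fun x hx y hy => mul_mem_smirnovT hC hx hy⟩
    rintro _ ⟨s, hs, rfl⟩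
    have h := tmul_self_sub_smul_one_add hC 1 (hconj_eq_neg_iff.mp hs)
    rw [one_smul F (_ ⊗ₜ[F] _ + _)] at h
    rw [SetLike.mem_coe, eq_sub_of_add_eq h.symm]
    exact sub_mem (Submodule.subset_span ⟨_, rfl⟩) (Submodule.subset_span ⟨s, rfl⟩)
end
end
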